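/- arXiv:2308.16272 — 6 statements merged into one kernel-verified Lean document; each statement's English description precedes it below -/
import Mathlib

section
/- Let d ≥ 2 be an integer and α ∈ (0,2). Then the integral over the open unit ball B(0,1) ⊂ ℝ^d of the density of the expected occupation measure V_1(0,dy), namely ∫_{B(0,1)} 2^{-α} π^{-d/2} (Γ(d/2)/Γ(α/2)^2) |y|^{α-d} (∫_0^{|y|^{-2}-1} (u+1)^{-d/2} u^{α/2-1} du) dy, equals κ_{d,α} = (2^{1-α}/α) · Γ(d/2)/(Γ(α/2) Γ(d/2+α/2)). In particular this integral is finite. -/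
open Real MeasureTheory

/-- κ_{d,α} = (2^{1-α}/α) · Γ(d/2)/(Γ(α/2) Γ(d/2+α/2)). -/
noncomputable def kappa (d : ℕ) (α : ℝ) : ℝ :=
  (2:ℝ) ^ (1 - α) / α * (Real.Gamma ((d:ℝ)/2) / (Real.Gamma (α/2) * Real.Gamma ((d:ℝ)/2 + α/2)))

/-- Density of the expected occupation measure V_1(0,dy). -/
noncomputable def occDensity (d : ℕ) (α : ℝ) (y : EuclideanSpace ℝ (Fin d)) : ℝ :=
  (2:ℝ) ^ (-α) * Real.pi ^ (-(d:ℝ)/2) * (Real.Gamma ((d:ℝ)/2) / (Real.Gamma (α/2))^2) *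
    ‖y‖ ^ (α - (d:ℝ)) *
    (∫ u in (0:ℝ)..(‖y‖ ^ (-(2:ℝ)) - 1), (u + 1) ^ (-(d:ℝ)/2) * u ^ (α/2 - 1))

open Set ProbabilityTheory in
/-- The Euler integral of the first kind, over the reals. -/
lemma integral_Ioo_rpow_mul_one_sub_rpow {a b : ℝ} (ha : 0 < a) (hb : 0 < b) :
    ∫ x in Ioo (0:ℝ) 1, x ^ (a - 1) * (1 - x) ^ (b - 1) = beta a b := by
  have h : ((∫ x in Ioo (0:ℝ) 1, x ^ (a - 1) * (1 - x) ^ (b - 1) : ℝ) : ℂ)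
      = Complex.betaIntegral a b := by
    rw [Complex.betaIntegral, intervalIntegral.integral_of_le zero_le_one,
      integral_Ioc_eq_integral_Ioo, ← integral_complex_ofReal]
    refine setIntegral_congr_fun measurableSet_Ioo fun x hx => ?_
    have h1 : 0 ≤ 1 - x := by linarith [hx.2]
    simp [Complex.ofReal_cpow hx.1.le, Complex.ofReal_cpow h1]
  rw [beta_eq_betaIntegralReal a b ha hb, ← h, Complex.ofReal_re]

open Set in
lemma image_div_one_sub_Ioo : (fun t : ℝ => t / (1 - t)) '' Ioo 0 1 = Ioi 0 := by
  ext u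
  constructor
  · rintro ⟨t, ht, rfl⟩
    exact div_pos ht.1 (by linarith [ht.2])
  · intro hu
    have hu : 0 < u := hu
    refine ⟨u / (u + 1), ⟨by positivity, (div_lt_one (by positivity)).2 (by linarith)⟩, ?_⟩
    have h : u + 1 ≠ 0 := by positivity
    field_simp
    ring

open Set ProbabilityTheory in
/-- The beta integral over the half-line. -/
lemma integral_Ioi_rpow_mul_add_one_rpow {a b : ℝ} (ha : 0 < a) (hb : 0 < b) :
    ∫ u in Ioi (0:ℝ), u ^ (a - 1) * (u + 1) ^ (-(a + b)) = beta a b := by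
  have hderiv : ∀ t ∈ Ioo (0:ℝ) 1,
      HasDerivWithinAt (fun t : ℝ => t / (1 - t)) (1 / (1 - t) ^ 2) (Ioo 0 1) t := by
    intro t ht
    have h1 : 1 - t ≠ 0 := by linarith [ht.2]
    convert! ((hasDerivAt_id t).div ((hasDerivAt_id t).const_sub 1) h1).hasDerivWithinAt using 1
    simp
  have hinj : InjOn (fun t : ℝ => t / (1 - t)) (Ioo 0 1) := by
    intro x hx y hy hxy
    have h1 : 1 - x ≠ 0 := by linarith [hx.2]
    have h2 : 1 - y ≠ 0 := by linarith [hy.2]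
    simp only at hxy
    rw [div_eq_div_iff h1 h2] at hxy
    linarith
  rw [← image_div_one_sub_Ioo,
    integral_image_eq_integral_abs_deriv_smul measurableSet_Ioo hderiv hinj,
    ← integral_Ioo_rpow_mul_one_sub_rpow ha hb]
  refine setIntegral_congr_fun measurableSet_Ioo fun t ht => ?_
  have h1 : 0 < 1 - t := by linarith [ht.2]
  have h2 : t / (1 - t) + 1 = (1 - t)⁻¹ := by field_simp; ring
  simp only [smul_eq_mul]
  rw [abs_of_nonneg (by positivity), h2, div_rpow ht.1.le h1.le, inv_rpow h1.le, ← rpow_neg h1.le,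
    one_div, ← rpow_natCast, ← rpow_neg h1.le, div_eq_mul_inv, ← rpow_neg h1.le]
  have h3 : (1 - t) ^ (b - 1)
      = (1 - t) ^ (-((2:ℕ):ℝ)) * (1 - t) ^ (-(a - 1)) * (1 - t) ^ (- -(a + b)) := by
    rw [← rpow_add h1, ← rpow_add h1]
    congr 1
    push_cast
    ring
  rw [h3]
  ring

open Set in
lemma integral_Ioi_ite_rpow {α c : ℝ} (hα : 0 < α) (hc : 0 < c) :
    ∫ r in Ioi (0:ℝ), (if r < c then r ^ (α - 1) else 0) = c ^ α / α := by
  have h : ∀ r : ℝ, (if r < c then r ^ (α - 1) else 0)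
      = (Iio c).indicator (fun r => r ^ (α - 1)) r := fun r => by simp [indicator]
  simp_rw [h]
  rw [setIntegral_indicator measurableSet_Iio, Ioi_inter_Iio, ← integral_Ioc_eq_integral_Ioo,
    ← intervalIntegral.integral_of_le hc.le, integral_rpow (Or.inl (by linarith))]
  simp [zero_rpow hα.ne']

lemma lt_add_one_rpow_neg_half_iff {r u : ℝ} (hr : 0 < r) (hu : 0 < u) :
    r < (u + 1) ^ (-(1:ℝ)/2) ↔ u < r ^ (-(2:ℝ)) - 1 := by
  have h : r = (r ^ (-(2:ℝ))) ^ (-(1:ℝ)/2) := by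
    rw [← rpow_mul hr.le]
    norm_num
  have h2 : 0 < r ^ (-(2:ℝ)) := by positivity
  conv_lhs => rw [h]
  rw [rpow_lt_rpow_iff_of_neg h2 (by positivity) (by norm_num), lt_sub_iff_add_lt]

open Set ProbabilityTheory in
lemma integral_radial_occupation {α s : ℝ} (hα : 0 < α) (hs : 0 < s) :
    ∫ r in Ioi (0:ℝ), (Iio (1:ℝ)).indicator (fun r => r ^ (α - 1) *
      ∫ u in (0:ℝ)..(r ^ (-(2:ℝ)) - 1), (u + 1) ^ (-s) * u ^ (α / 2 - 1)) r
      = beta (α / 2) s / α := by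
  set f : ℝ → ℝ → ℝ := fun u r =>
    (if r < (u + 1) ^ (-(1:ℝ)/2) then r ^ (α - 1) else 0) *
      ((u + 1) ^ (-s) * u ^ (α / 2 - 1)) with hf
  have hinner : ∀ u ∈ Ioi (0:ℝ), ∫ r in Ioi (0:ℝ), f u r
      = (1 / α) * (u ^ (α / 2 - 1) * (u + 1) ^ (-(α / 2 + s))) := by
    intro u hu
    have hu : 0 < u := hu
    have h1 : 0 < u + 1 := by linarith
    rw [hf]
    simp only
    rw [integral_mul_const, integral_Ioi_ite_rpow hα (by positivity), ← rpow_mul h1.le,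
      show -(α / 2 + s) = -1 / 2 * α + -s by ring, rpow_add h1]
    ring
  have hnonneg : ∀ u ∈ Ioi (0:ℝ), ∀ r ∈ Ioi (0:ℝ), 0 ≤ f u r := by
    intro u hu r hr
    have hu : 0 < u := hu
    have hr : 0 < r := hr
    rw [hf]
    simp only
    split_ifs <;> positivity
  have hbeta := integral_Ioi_rpow_mul_add_one_rpow (half_pos hα) hs
  have hpos : 0 < beta (α / 2) s := beta_pos (half_pos hα) hs
  have htotal : ∫ u in Ioi (0:ℝ), ∫ r in Ioi (0:ℝ), f u r = beta (α / 2) s / α := by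
    rw [setIntegral_congr_fun measurableSet_Ioi hinner, integral_const_mul, hbeta]
    ring
  have hmeas : Measurable (Function.uncurry f) := by
    rw [hf]
    refine Measurable.mul (Measurable.ite (measurableSet_lt ?_ ?_) ?_ ?_) ?_ <;> fun_prop
  have hint : Integrable (Function.uncurry f)
      ((volume.restrict (Ioi (0:ℝ))).prod (volume.restrict (Ioi (0:ℝ)))) := by
    rw [integrable_prod_iff hmeas.aestronglyMeasurable]
    constructor
    · filter_upwards [ae_restrict_mem measurableSet_Ioi] with u hu
      apply Integrable.of_integral_ne_zero
      have hu' : 0 < u := hu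
      simp only [Function.uncurry]
      rw [hinner u hu]
      positivity
    · apply Integrable.of_integral_ne_zero
      have : ∫ u in Ioi (0:ℝ), ∫ r in Ioi (0:ℝ), ‖Function.uncurry f (u, r)‖
          = beta (α / 2) s / α := by
        rw [← htotal]
        refine setIntegral_congr_fun measurableSet_Ioi fun u hu => ?_
        refine setIntegral_congr_fun measurableSet_Ioi fun r hr => ?_
        exact norm_of_nonneg (hnonneg u hu r hr)
      rw [this]
      positivity
  rw [← htotal, integral_integral_swap hint]
  refine setIntegral_congr_fun measurableSet_Ioi fun r hr => ?_
  have hr : 0 < r := hr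
  have hfr : ∀ u ∈ Ioi (0:ℝ), f u r = r ^ (α - 1) *
      (Iio (r ^ (-(2:ℝ)) - 1)).indicator (fun u => (u + 1) ^ (-s) * u ^ (α / 2 - 1)) u := by
    intro u hu
    simp only [hf, lt_add_one_rpow_neg_half_iff hr hu, indicator, mem_Iio]
    split_ifs <;> simp
  rw [setIntegral_congr_fun measurableSet_Ioi hfr, integral_const_mul,
    setIntegral_indicator measurableSet_Iio, Ioi_inter_Iio]
  by_cases hr1 : r < 1
  · have h1 : 0 ≤ r ^ (-(2:ℝ)) - 1 :=
      sub_nonneg.2 (one_le_rpow_of_pos_of_le_one_of_nonpos hr hr1.le (by norm_num))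
    rw [indicator_of_mem (mem_Iio.2 hr1), intervalIntegral.integral_of_le h1,
      integral_Ioc_eq_integral_Ioo]
  · have h1 : r ^ (-(2:ℝ)) - 1 ≤ 0 :=
      sub_nonpos.2 (rpow_le_one_of_one_le_of_nonpos (not_lt.1 hr1) (by norm_num))
    rw [indicator_of_notMem (by simpa using hr1), Ioo_eq_empty (not_lt.2 h1)]
    simp

lemma kappa_pos {d : ℕ} (hd : 0 < d) {α : ℝ} (hα : 0 < α) : 0 < kappa d α := by
  have hd' : (0:ℝ) < d := by exact_mod_cast hd
  have h1 := Gamma_pos_of_pos (half_pos hd')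
  have h2 := Gamma_pos_of_pos (half_pos hα)
  have h3 := Gamma_pos_of_pos (add_pos (half_pos hd') (half_pos hα))
  unfold kappa
  positivity

open Set ProbabilityTheory in
lemma integral_ball_occDensity {d : ℕ} (hd : 0 < d) {α : ℝ} (hα : 0 < α) :
    ∫ y in Metric.ball (0 : EuclideanSpace ℝ (Fin d)) 1, occDensity d α y = kappa d α := by
  have hd' : (0:ℝ) < d := by exact_mod_cast hd
  have : Nonempty (Fin d) := ⟨⟨0, hd⟩⟩
  set C : ℝ := (2:ℝ) ^ (-α) * π ^ (-(d:ℝ)/2) * (Gamma ((d:ℝ)/2) / (Gamma (α/2))^2) with hC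
  set φ : ℝ → ℝ := fun r => C * r ^ (α - (d:ℝ)) *
    ∫ u in (0:ℝ)..(r ^ (-(2:ℝ)) - 1), (u + 1) ^ (-(d:ℝ)/2) * u ^ (α/2 - 1) with hφ
  have h1 : ∫ y in Metric.ball (0 : EuclideanSpace ℝ (Fin d)) 1, occDensity d α y
      = ∫ y : EuclideanSpace ℝ (Fin d), (Iio (1:ℝ)).indicator φ ‖y‖ := by
    rw [← integral_indicator measurableSet_ball]
    refine integral_congr_ae (.of_forall fun y => ?_)
    simp [indicator, hφ, hC, occDensity]
  have h2 : ∀ r ∈ Ioi (0:ℝ), r ^ (d - 1) • (Iio (1:ℝ)).indicator φ r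
      = C * (Iio (1:ℝ)).indicator (fun r => r ^ (α - 1) *
      ∫ u in (0:ℝ)..(r ^ (-(2:ℝ)) - 1), (u + 1) ^ (-((d:ℝ) / 2)) * u ^ (α / 2 - 1)) r := by
    intro r hr
    have hr : 0 < r := hr
    simp only [indicator, mem_Iio]
    split_ifs with h
    · have h3 : r ^ (α - 1) = r ^ (d - 1) * r ^ (α - (d:ℝ)) := by
        rw [← rpow_natCast, ← rpow_add hr, Nat.cast_sub (by lia)]
        congr 1
        push_cast
        ring
      simp only [hφ, h3, neg_div, smul_eq_mul]
      ring
    · simp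
  have hvol : volume.real (Metric.ball (0 : EuclideanSpace ℝ (Fin d)) 1)
      = π ^ ((d:ℝ) / 2) / ((d:ℝ) / 2 * Gamma ((d:ℝ) / 2)) := by
    have hG := Gamma_pos_of_pos (half_pos hd')
    rw [measureReal_def, EuclideanSpace.volume_ball, Fintype.card_fin,
      Gamma_add_one (half_pos hd').ne', sqrt_eq_rpow, ← rpow_natCast, ← rpow_mul pi_pos.le,
      ENNReal.ofReal_one, one_pow, one_mul, ENNReal.toReal_ofReal (by positivity)]
    ring_nf
  have : Nontrivial (EuclideanSpace ℝ (Fin d)) :=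
    Module.nontrivial_of_finrank_pos (R := ℝ) (by simpa using hd)
  rw [h1, integral_fun_norm_addHaar, finrank_euclideanSpace, Fintype.card_fin,
    setIntegral_congr_fun measurableSet_Ioi h2, integral_const_mul,
    integral_radial_occupation hα (half_pos hd'), hvol, kappa, beta, hC, nsmul_eq_mul, smul_eq_mul,
    neg_div, rpow_neg pi_pos.le, sub_eq_add_neg, rpow_add two_pos, rpow_one,
    add_comm (α / 2) ((d:ℝ) / 2)]
  have hG1 := (Gamma_pos_of_pos (half_pos hd')).ne'
  have hG2 := (Gamma_pos_of_pos (half_pos hα)).ne'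
  have hG3 := (Gamma_pos_of_pos (add_pos (half_pos hd') (half_pos hα))).ne'
  have hπ : π ^ ((d:ℝ) / 2) ≠ 0 := by positivity
  generalize Gamma ((d:ℝ) / 2 + α / 2) = G3 at *
  generalize Gamma ((d:ℝ) / 2) = G1 at *
  generalize Gamma (α / 2) = G2 at *
  generalize π ^ ((d:ℝ) / 2) = P at *
  field_simp

theorem stmt0 (d : ℕ) (hd : 2 ≤ d) (α : ℝ) (hα : α ∈ Set.Ioo (0:ℝ) 2) :
    (∫ y in Metric.ball (0 : EuclideanSpace ℝ (Fin d)) 1, occDensity d α y) = kappa d α ∧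
    IntegrableOn (occDensity d α) (Metric.ball (0 : EuclideanSpace ℝ (Fin d)) 1) := by
  have h := integral_ball_occDensity (by lia : 0 < d) hα.1
  refine ⟨h, Integrable.of_integral_ne_zero ?_⟩
  rw [h]
  exact (kappa_pos (by lia) hα.1).ne'
end

section
/- Let d ≥ 2 be an integer and α ∈ (0,2). Then ∫_0^1 r^{α-1} I(r^2; d/2-α/2, α/2) dr = 1/α - Γ(d/2)^2 / (α Γ(d/2-α/2) Γ(d/2+α/2)). -/
open Real MeasureTheory

/-- Beta function B(z,w) = Γ(z)Γ(w)/Γ(z+w). -/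
noncomputable def betaFn (z w : ℝ) : ℝ :=
  Real.Gamma z * Real.Gamma w / Real.Gamma (z + w)

/-- Regularized incomplete Beta function I(x; z, w). -/
noncomputable def regIncBeta (x z w : ℝ) : ℝ :=
  (∫ u in (0:ℝ)..x, u ^ (z - 1) * (1 - u) ^ (w - 1)) / betaFn z w

/-- The Beta density is integrable on the unit interval. -/
theorem intervalIntegrable_rpow_mul_one_sub_rpow {z w : ℝ} (hz : 0 < z) (hw : 0 < w) :
    IntervalIntegrable (fun u : ℝ => u ^ (z - 1) * (1 - u) ^ (w - 1)) volume 0 1 := by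
  have h := Complex.betaIntegral_convergent (u := (z : ℂ)) (v := (w : ℂ)) (by simpa) (by simpa)
  rw [intervalIntegrable_iff_integrableOn_Ioc_of_le zero_le_one] at h ⊢
  refine MeasureTheory.IntegrableOn.congr_fun h.re (fun u hu => ?_) measurableSet_Ioc
  have h1 : 0 ≤ u := hu.1.le
  have h2 : 0 ≤ 1 - u := sub_nonneg.2 hu.2
  have e : (u : ℂ) ^ ((z : ℂ) - 1) * (1 - (u : ℂ)) ^ ((w : ℂ) - 1)
      = ((u ^ (z - 1) * (1 - u) ^ (w - 1) : ℝ) : ℂ) := by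
    push_cast
    rw [Complex.ofReal_cpow h1, Complex.ofReal_cpow h2]
    push_cast
    rfl
  simp only [e]
  exact Complex.ofReal_re _

/-- Euler's integral for the real Beta function. -/
theorem integral_rpow_mul_one_sub_rpow {z w : ℝ} (hz : 0 < z) (hw : 0 < w) :
    (∫ u in (0 : ℝ)..1, u ^ (z - 1) * (1 - u) ^ (w - 1)) = betaFn z w := by
  have h := Complex.betaIntegral_eq_Gamma_mul_div (z : ℂ) (w : ℂ) (by simpa) (by simpa)
  have e : Complex.betaIntegral z w
      = ((∫ u in (0 : ℝ)..1, u ^ (z - 1) * (1 - u) ^ (w - 1) : ℝ) : ℂ) := by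
    rw [Complex.betaIntegral, ← intervalIntegral.integral_ofReal]
    refine intervalIntegral.integral_congr fun u hu => ?_
    rw [Set.uIcc_of_le zero_le_one] at hu
    have h1 : 0 ≤ u := hu.1
    have h2 : 0 ≤ 1 - u := sub_nonneg.2 hu.2
    push_cast
    rw [Complex.ofReal_cpow h1, Complex.ofReal_cpow h2]
    push_cast
    rfl
  rw [e, ← Complex.ofReal_add, Complex.Gamma_ofReal, Complex.Gamma_ofReal,
    Complex.Gamma_ofReal] at h
  rw [betaFn]
  exact_mod_cast h

theorem continuousOn_integral_rpow_mul_one_sub_rpow {z w : ℝ} (hz : 0 < z) (hw : 0 < w) :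
    ContinuousOn (fun x : ℝ => ∫ u in (0 : ℝ)..x, u ^ (z - 1) * (1 - u) ^ (w - 1))
      (Set.Icc 0 1) := by
  have h := intervalIntegrable_rpow_mul_one_sub_rpow hz hw
  have := intervalIntegral.continuousOn_primitive_interval' h (a := 0) (by simp)
  rwa [Set.uIcc_of_le zero_le_one] at this

theorem hasDerivAt_integral_rpow_mul_one_sub_rpow {z w x : ℝ} (hz : 0 < z) (hw : 0 < w)
    (hx : x ∈ Set.Ioo (0 : ℝ) 1) :
    HasDerivAt (fun x : ℝ => ∫ u in (0 : ℝ)..x, u ^ (z - 1) * (1 - u) ^ (w - 1))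
      (x ^ (z - 1) * (1 - x) ^ (w - 1)) x := by
  have hmeas : Measurable fun u : ℝ => u ^ (z - 1) * (1 - u) ^ (w - 1) := by fun_prop
  refine intervalIntegral.integral_hasDerivAt_right ?_
    hmeas.stronglyMeasurable.stronglyMeasurableAtFilter ?_
  · refine (intervalIntegrable_rpow_mul_one_sub_rpow hz hw).mono_set ?_
    rw [Set.uIcc_of_le hx.1.le, Set.uIcc_of_le zero_le_one]
    exact Set.Icc_subset_Icc_right hx.2.le
  · have h1 : x ≠ 0 := hx.1.ne'
    have h2 : 1 - x ≠ 0 := (sub_pos.2 hx.2).ne'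
    exact (continuousAt_id.rpow_const (Or.inl h1)).mul
      ((continuousAt_const.sub continuousAt_id).rpow_const (Or.inl h2))

/-- Power moment of the incomplete Beta function at a squared argument. -/
theorem integral_rpow_mul_incBeta_sq {z w : ℝ} (hz : 0 < z) (hw : 0 < w) :
    (∫ r in (0 : ℝ)..1,
        r ^ (2 * w - 1) * ∫ u in (0 : ℝ)..r ^ 2, u ^ (z - 1) * (1 - u) ^ (w - 1))
      = (betaFn z w - betaFn (z + w) w) / (2 * w) := by
  have hzw : 0 < z + w := add_pos hz hw
  have hmaps : Set.MapsTo (fun r : ℝ => r ^ 2) (Set.Icc 0 1) (Set.Icc 0 1) := fun r hr =>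
    ⟨sq_nonneg r, pow_le_one₀ hr.1 hr.2⟩
  have hcont {a : ℝ} (ha : 0 < a) :
      ContinuousOn (fun r : ℝ => ∫ u in (0 : ℝ)..r ^ 2, u ^ (a - 1) * (1 - u) ^ (w - 1))
        (Set.Icc 0 1) :=
    (continuousOn_integral_rpow_mul_one_sub_rpow ha hw).comp (by fun_prop) hmaps
  have hpow : ContinuousOn (fun r : ℝ => r ^ (2 * w)) (Set.Icc 0 1) :=
    (Real.continuous_rpow_const (by positivity)).continuousOn
  rw [intervalIntegral.integral_eq_sub_of_hasDerivAt_of_le zero_le_one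
    (f := fun r : ℝ =>
      (r ^ (2 * w) * (∫ u in (0 : ℝ)..r ^ 2, u ^ (z - 1) * (1 - u) ^ (w - 1))
        - ∫ u in (0 : ℝ)..r ^ 2, u ^ (z + w - 1) * (1 - u) ^ (w - 1)) / (2 * w))
    (((hpow.mul (hcont hz)).sub (hcont hzw)).div_const _)]
  · simp only [one_pow, integral_rpow_mul_one_sub_rpow hz hw, integral_rpow_mul_one_sub_rpow hzw hw]
    simp
  · intro r hr
    have hr0 : 0 < r := hr.1
    have hr2 : r ^ 2 ∈ Set.Ioo (0 : ℝ) 1 :=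
      ⟨by positivity, pow_lt_one₀ hr0.le hr.2 two_ne_zero⟩
    have hsq : HasDerivAt (fun r : ℝ => r ^ 2) (2 * r) r := by simpa using hasDerivAt_pow 2 r
    have hF := (hasDerivAt_integral_rpow_mul_one_sub_rpow hz hw hr2).comp (h := fun r : ℝ => r ^ 2) r hsq
    have hK := (hasDerivAt_integral_rpow_mul_one_sub_rpow hzw hw hr2).comp (h := fun r : ℝ => r ^ 2) r hsq
    have hp := Real.hasDerivAt_rpow_const (x := r) (p := 2 * w) (Or.inl hr0.ne')
    refine (((hp.mul hF).sub hK).div_const (2 * w)).congr_deriv ?_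
    have e : (r ^ 2) ^ (z + w - 1) = (r ^ 2) ^ (z - 1) * r ^ (2 * w) := by
      rw [show z + w - 1 = (z - 1) + w by ring, Real.rpow_add hr2.1, Real.rpow_mul hr0.le]
      norm_cast
    simp only [Function.comp_apply, e]
    field_simp
    ring
  · refine IntervalIntegrable.mul_continuousOn
      (intervalIntegral.intervalIntegrable_rpow' (by linarith)) ?_
    rw [Set.uIcc_of_le zero_le_one]
    exact hcont hz

theorem stmt2 (d : ℕ) (hd : 2 ≤ d) (α : ℝ) (hα : α ∈ Set.Ioo (0:ℝ) 2) :
    (∫ r in (0:ℝ)..1, r ^ (α - 1) * regIncBeta (r^2) ((d:ℝ)/2 - α/2) (α/2))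
      = 1/α - Real.Gamma ((d:ℝ)/2) ^ 2
          / (α * Real.Gamma ((d:ℝ)/2 - α/2) * Real.Gamma ((d:ℝ)/2 + α/2)) := by
  obtain ⟨h0, h2⟩ := hα
  have hd' : (2 : ℝ) ≤ d := by exact_mod_cast hd
  have hz : 0 < (d : ℝ) / 2 - α / 2 := by linarith
  have hw : 0 < α / 2 := by linarith
  have key := integral_rpow_mul_incBeta_sq hz hw
  rw [mul_div_cancel₀ α two_ne_zero] at key
  simp only [regIncBeta, ← mul_div_assoc, intervalIntegral.integral_div]
  rw [key]
  simp only [betaFn, sub_add_cancel]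
  have g1 := (Real.Gamma_pos_of_pos hz).ne'
  have g2 := (Real.Gamma_pos_of_pos hw).ne'
  have g3 := (Real.Gamma_pos_of_pos (show 0 < (d : ℝ) / 2 by linarith)).ne'
  have g4 := (Real.Gamma_pos_of_pos (show 0 < (d : ℝ) / 2 + α / 2 by linarith)).ne'
  generalize Real.Gamma ((d : ℝ) / 2 - α / 2) = a at *
  generalize Real.Gamma ((d : ℝ) / 2 + α / 2) = b at *
  field_simp
end

section
/- Let d ≥ 2 be an integer and α ∈ (0,2). Then ∫_0^1 r^{α-1} (1 - I(r^2; d/2-α/2, α/2)) dr = Γ(d/2)^2 / (α Γ(d/2-α/2) Γ(d/2+α/2)). -/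
open Real MeasureTheory

/-- The integrand of the Beta integral `B(z, w)`. -/
noncomputable def betaIntegrand (z w u : ℝ) : ℝ :=
  u ^ (z - 1) * (1 - u) ^ (w - 1)

theorem ofReal_betaIntegrand {z w x : ℝ} (hx : x ∈ Set.Icc (0 : ℝ) 1) :
    (betaIntegrand z w x : ℂ) = (x : ℂ) ^ ((z : ℂ) - 1) * (1 - (x : ℂ)) ^ ((w : ℂ) - 1) := by
  rw [betaIntegrand, Complex.ofReal_mul, Complex.ofReal_cpow hx.1,
    Complex.ofReal_cpow (sub_nonneg.2 hx.2)]
  push_cast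
  rfl

theorem intervalIntegrable_betaIntegrand {z w : ℝ} (hz : 0 < z) (hw : 0 < w) :
    IntervalIntegrable (betaIntegrand z w) volume 0 1 := by
  have h := (Complex.betaIntegral_convergent (u := z) (v := w) (by simpa) (by simpa))
  rw [intervalIntegrable_iff, Set.uIoc_of_le zero_le_one] at h ⊢
  refine IntegrableOn.congr_fun h.re (fun x hx => ?_) measurableSet_Ioc
  simp only [← ofReal_betaIntegrand (Set.Ioc_subset_Icc_self hx)]
  exact Complex.ofReal_re _

theorem integral_betaIntegrand {z w : ℝ} (hz : 0 < z) (hw : 0 < w) :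
    ∫ u in (0 : ℝ)..1, betaIntegrand z w u = betaFn z w := by
  have h : Complex.betaIntegral z w = ((∫ u in (0 : ℝ)..1, betaIntegrand z w u : ℝ) : ℂ) := by
    rw [Complex.betaIntegral, ← intervalIntegral.integral_ofReal]
    refine intervalIntegral.integral_congr fun x hx => ?_
    rw [Set.uIcc_of_le zero_le_one] at hx
    exact (ofReal_betaIntegrand hx).symm
  have hb := ProbabilityTheory.beta_eq_betaIntegralReal z w hz hw
  rw [h, Complex.ofReal_re] at hb
  exact hb.symm

theorem continuousOn_integral_betaIntegrand_sq {z w : ℝ} (hz : 0 < z) (hw : 0 < w) :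
    ContinuousOn (fun r : ℝ => ∫ u in (0 : ℝ)..r ^ 2, betaIntegrand z w u) (Set.Icc 0 1) := by
  have h := intervalIntegral.continuousOn_primitive_interval'
    (intervalIntegrable_betaIntegrand hz hw) Set.left_mem_uIcc
  rw [Set.uIcc_of_le zero_le_one] at h
  exact h.comp (by fun_prop) fun r hr => ⟨sq_nonneg r, pow_le_one₀ hr.1 hr.2⟩

theorem hasDerivAt_integral_betaIntegrand_sq {z w r : ℝ} (hz : 0 < z) (hw : 0 < w)
    (hr : r ∈ Set.Ioo (0 : ℝ) 1) :
    HasDerivAt (fun r : ℝ => ∫ u in (0 : ℝ)..r ^ 2, betaIntegrand z w u)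
      (betaIntegrand z w (r ^ 2) * (2 * r)) r := by
  have h0 : 0 < r ^ 2 := pow_pos hr.1 2
  have h1 : r ^ 2 < 1 := pow_lt_one₀ hr.1.le hr.2 two_ne_zero
  have hInt : IntervalIntegrable (betaIntegrand z w) volume 0 (r ^ 2) :=
    (intervalIntegrable_betaIntegrand hz hw).mono_set
      (by rw [Set.uIcc_of_le h0.le, Set.uIcc_of_le zero_le_one]
          exact Set.Icc_subset_Icc_right h1.le)
  have hmeas : Measurable (betaIntegrand z w) := by
    unfold betaIntegrand
    fun_prop
  have hcont : ContinuousAt (betaIntegrand z w) (r ^ 2) :=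
    (continuousAt_id.rpow_const (Or.inl h0.ne')).mul
      ((continuousAt_const.sub continuousAt_id).rpow_const (Or.inl (sub_pos.2 h1).ne'))
  have hsq : HasDerivAt (fun r : ℝ => r ^ 2) (2 * r) r := by
    simpa using hasDerivAt_pow 2 r
  exact (intervalIntegral.integral_hasDerivAt_right hInt
    hmeas.stronglyMeasurable.stronglyMeasurableAtFilter hcont).comp_of_eq r hsq rfl

theorem betaFn_pos {z w : ℝ} (hz : 0 < z) (hw : 0 < w) : 0 < betaFn z w :=
  ProbabilityTheory.beta_pos hz hw

theorem rpow_mul_betaIntegrand_sq {r : ℝ} (hr : 0 < r) (a z w : ℝ) :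
    r ^ a * betaIntegrand z w (r ^ 2) = betaIntegrand (z + a / 2) w (r ^ 2) := by
  have h : r ^ a = (r ^ 2) ^ (a / 2) := by
    rw [← Real.rpow_natCast_mul hr.le]
    congr 1
    push_cast
    ring
  rw [betaIntegrand, betaIntegrand, h, ← mul_assoc, ← Real.rpow_add (pow_pos hr 2)]
  congr 2
  ring

/-- The Mellin transform of `r ↦ 1 - I(r²; z, w)` on `[0, 1]`. -/
theorem integral_rpow_mul_one_sub_regIncBeta_sq {a z w : ℝ} (ha : 0 < a) (hz : 0 < z)
    (hw : 0 < w) :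
    ∫ r in (0 : ℝ)..1, r ^ (a - 1) * (1 - regIncBeta (r ^ 2) z w)
      = betaFn (z + a / 2) w / (a * betaFn z w) := by
  have hz' : 0 < z + a / 2 := by positivity
  have hB : betaFn z w ≠ 0 := (betaFn_pos hz hw).ne'
  have hreg (x : ℝ) : regIncBeta x z w = (∫ u in (0 : ℝ)..x, betaIntegrand z w u) / betaFn z w :=
    rfl
  have hcI : ContinuousOn (fun r : ℝ => 1 - regIncBeta (r ^ 2) z w) (Set.Icc 0 1) :=
    continuousOn_const.sub ((continuousOn_integral_betaIntegrand_sq hz hw).div_const _)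
  have hcont : ContinuousOn (fun r : ℝ => r ^ a / a * (1 - regIncBeta (r ^ 2) z w)
      + (∫ u in (0 : ℝ)..r ^ 2, betaIntegrand (z + a / 2) w u) / (a * betaFn z w))
      (Set.Icc 0 1) :=
    ((((Real.continuous_rpow_const ha.le).div_const a).continuousOn).mul hcI).add
      ((continuousOn_integral_betaIntegrand_sq hz' hw).div_const _)
  have hderiv : ∀ r ∈ Set.Ioo (0 : ℝ) 1,
      HasDerivAt (fun r : ℝ => r ^ a / a * (1 - regIncBeta (r ^ 2) z w)
        + (∫ u in (0 : ℝ)..r ^ 2, betaIntegrand (z + a / 2) w u) / (a * betaFn z w))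
        (r ^ (a - 1) * (1 - regIncBeta (r ^ 2) z w)) r := by
    intro r hr
    convert! (((Real.hasDerivAt_rpow_const (p := a) (Or.inl hr.1.ne')).div_const a).mul
      (((hasDerivAt_integral_betaIntegrand_sq hz hw hr).div_const (betaFn z w)).const_sub 1)).add
      ((hasDerivAt_integral_betaIntegrand_sq hz' hw hr).div_const (a * betaFn z w)) using 1
    rw [← rpow_mul_betaIntegrand_sq hr.1, hreg]
    field_simp
    ring
  have hInt : IntervalIntegrable (fun r : ℝ => r ^ (a - 1) * (1 - regIncBeta (r ^ 2) z w))
      volume 0 1 :=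
    (intervalIntegral.intervalIntegrable_rpow' (by linarith)).mul_continuousOn
      (by rwa [Set.uIcc_of_le zero_le_one])
  rw [intervalIntegral.integral_eq_sub_of_hasDerivAt_of_le zero_le_one hcont hderiv hInt]
  simp [hreg, integral_betaIntegrand hz hw, integral_betaIntegrand hz' hw, hB,
    Real.zero_rpow ha.ne']

theorem stmt3 (d : ℕ) (hd : 2 ≤ d) (α : ℝ) (hα : α ∈ Set.Ioo (0:ℝ) 2) :
    (∫ r in (0:ℝ)..1, r ^ (α - 1) * (1 - regIncBeta (r^2) ((d:ℝ)/2 - α/2) (α/2)))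
      = Real.Gamma ((d:ℝ)/2) ^ 2
          / (α * Real.Gamma ((d:ℝ)/2 - α/2) * Real.Gamma ((d:ℝ)/2 + α/2)) := by
  have hα0 : 0 < α := hα.1
  have hd' : (2 : ℝ) ≤ d := by exact_mod_cast hd
  have hz : 0 < (d : ℝ) / 2 - α / 2 := by linarith [hα.2]
  have hw : 0 < α / 2 := by linarith
  rw [integral_rpow_mul_one_sub_regIncBeta_sq hα0 hz hw, betaFn, betaFn, sub_add_cancel]
  have h1 := (Real.Gamma_pos_of_pos hz).ne'
  have h2 := (Real.Gamma_pos_of_pos hw).ne'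
  have h3 : Real.Gamma ((d : ℝ) / 2) ≠ 0 := (Real.Gamma_pos_of_pos (by linarith)).ne'
  have h4 : Real.Gamma ((d : ℝ) / 2 + α / 2) ≠ 0 := (Real.Gamma_pos_of_pos (by linarith)).ne'
  field_simp
end

section
/- Let d ≥ 2 be an integer and α ∈ (0,2). Then the exit density of the isotropic α-stable process from the unit ball integrates to one over the exterior of the ball: ∫_{{y ∈ ℝ^d : |y| > 1}} π^{-(d/2+1)} Γ(d/2) sin(πα/2) (|y|^2 - 1)^{-α/2} |y|^{-d} dy = 1. In particular, the integrand is integrable on {y ∈ ℝ^d : |y| > 1}. -/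
open Real MeasureTheory

/-- Exit density of the isotropic α-stable process from the unit ball. -/
noncomputable def exitDensity (d : ℕ) (α : ℝ) (y : EuclideanSpace ℝ (Fin d)) : ℝ :=
  Real.pi ^ (-((d:ℝ)/2 + 1)) * Real.Gamma ((d:ℝ)/2) * Real.sin (Real.pi * α / 2) *
    (‖y‖^2 - 1) ^ (-(α/2)) * ‖y‖ ^ (-(d:ℝ))

theorem integral_Ioo_rpow_mul_one_sub_rpow_s4 {u v : ℝ} (hu : 0 < u) (hv : 0 < v) :
    ∫ x in Set.Ioo (0:ℝ) 1, x ^ (u - 1) * (1 - x) ^ (v - 1) =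
      Gamma u * Gamma v / Gamma (u + v) := by
  have h := Complex.betaIntegral_eq_Gamma_mul_div u v (by simpa) (by simpa)
  rw [Complex.betaIntegral, intervalIntegral.integral_of_le zero_le_one,
    integral_Ioc_eq_integral_Ioo, ← Complex.ofReal_add, Complex.Gamma_ofReal,
    Complex.Gamma_ofReal, Complex.Gamma_ofReal] at h
  rw [← Complex.ofReal_inj, ← integral_complex_ofReal]
  push_cast
  rw [← h]
  refine setIntegral_congr_fun measurableSet_Ioo fun x hx ↦ ?_
  rw [Complex.ofReal_cpow hx.1.le, Complex.ofReal_cpow (sub_nonneg.2 hx.2.le)]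
  push_cast
  rfl

theorem image_sq_inv_Ioi_one :
    Set.image (fun r : ℝ ↦ (r ^ 2)⁻¹) (Set.Ioi 1) = Set.Ioo 0 1 := by
  ext u
  constructor
  · rintro ⟨r, hr : 1 < r, rfl⟩
    exact ⟨by positivity, inv_lt_one_of_one_lt₀ (by nlinarith)⟩
  · rintro ⟨h0, h1⟩
    have hs : 0 < √u := sqrt_pos.2 h0
    refine ⟨(√u)⁻¹, ?_, ?_⟩
    · exact (one_lt_inv₀ hs).2 ((sqrt_lt' one_pos).2 (by simpa))
    · simp [sq_sqrt h0.le]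

theorem integral_Ioi_sq_sub_one_rpow_neg_mul_inv {a : ℝ} (ha : a ∈ Set.Ioo (0:ℝ) 1) :
    ∫ r in Set.Ioi (1:ℝ), (r ^ 2 - 1) ^ (-a) * r⁻¹ = π / (2 * sin (π * a)) := by
  have hd : ∀ r ∈ Set.Ioi (1:ℝ), HasDerivWithinAt (fun r : ℝ ↦ (r ^ 2)⁻¹)
      (-(2 * r) / (r ^ 2) ^ 2) (Set.Ioi 1) r := fun r (hr : 1 < r) ↦ by
    simpa using ((hasDerivAt_pow 2 r).fun_inv (by positivity)).hasDerivWithinAt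
  have hinj : Set.InjOn (fun r : ℝ ↦ (r ^ 2)⁻¹) (Set.Ioi 1) :=
    fun r (hr : 1 < r) s (hs : 1 < s) h ↦
      (pow_left_inj₀ (by positivity) (by positivity) two_ne_zero).1 (inv_injective h)
  have h := integral_image_eq_integral_abs_deriv_smul measurableSet_Ioi hd hinj
    fun x ↦ x ^ (a - 1) * (1 - x) ^ (1 - a - 1)
  rw [image_sq_inv_Ioi_one, integral_Ioo_rpow_mul_one_sub_rpow_s4 ha.1 (sub_pos.2 ha.2),
    add_sub_cancel, Gamma_one, div_one, Real.Gamma_mul_Gamma_one_sub] at h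
  have hcongr : ∀ r ∈ Set.Ioi (1:ℝ),
      |(-(2 * r) / (r ^ 2) ^ 2)| • (((r ^ 2)⁻¹) ^ (a - 1) * (1 - (r ^ 2)⁻¹) ^ (1 - a - 1)) =
        2 * ((r ^ 2 - 1) ^ (-a) * r⁻¹) := fun r (hr : 1 < r) ↦ by
    have h0 : 0 < r := by positivity
    have h1 : 0 < r ^ 2 - 1 := by nlinarith
    have h2 : 1 - (r ^ 2)⁻¹ = (r ^ 2 - 1) * (r ^ 2)⁻¹ := by field_simp
    have h3 : ((r ^ 2)⁻¹) ^ (a - 1) * ((r ^ 2)⁻¹) ^ (-a) = r ^ 2 := by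
      rw [← rpow_add (by positivity), show a - 1 + -a = -1 by ring, rpow_neg_one, inv_inv]
    rw [show 1 - a - 1 = -a by ring, h2, mul_rpow h1.le (by positivity), neg_div, abs_neg,
      abs_of_pos (by positivity), smul_eq_mul, mul_left_comm (((r ^ 2)⁻¹) ^ (a - 1)), h3]
    field_simp
  rw [setIntegral_congr_fun measurableSet_Ioi hcongr, integral_const_mul] at h
  rw [mul_comm 2, ← div_div, h]
  ring

theorem integral_exterior_unitBall_fun_norm {d : ℕ} (hd : d ≠ 0) (f : ℝ → ℝ) :
    ∫ y in {y : EuclideanSpace ℝ (Fin d) | 1 < ‖y‖}, f ‖y‖ =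
      2 * π ^ ((d:ℝ) / 2) / Gamma ((d:ℝ) / 2) * ∫ r in Set.Ioi (1:ℝ), r ^ (d - 1) * f r := by
  have : NeZero d := ⟨hd⟩
  have hm : MeasurableSet {y : EuclideanSpace ℝ (Fin d) | 1 < ‖y‖} :=
    measurableSet_lt measurable_const measurable_norm
  have hball : volume.real (Metric.ball (0 : EuclideanSpace ℝ (Fin d)) 1) =
      π ^ ((d:ℝ) / 2) / Gamma ((d:ℝ) / 2 + 1) := by
    have hG : 0 < Gamma ((d:ℝ) / 2 + 1) := Gamma_pos_of_pos (by positivity)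
    rw [measureReal_def, EuclideanSpace.volume_ball, Fintype.card_fin, ENNReal.ofReal_one,
      one_pow, one_mul, ENNReal.toReal_ofReal (by positivity), sqrt_eq_rpow, ← rpow_natCast,
      ← rpow_mul pi_pos.le]
    ring_nf
  have hd' : (0:ℝ) < d := by positivity
  have hG : 0 < Gamma ((d:ℝ) / 2) := Gamma_pos_of_pos (by positivity)
  have hind : (fun y : EuclideanSpace ℝ (Fin d) ↦ (Set.Ioi 1).indicator f ‖y‖) =
      {y | 1 < ‖y‖}.indicator fun y ↦ f ‖y‖ := by
    ext y
    simp [Set.indicator]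
  have hind' : (fun r : ℝ ↦ r ^ (d - 1) • (Set.Ioi 1).indicator f r) =
      (Set.Ioi 1).indicator fun r ↦ r ^ (d - 1) * f r := by
    ext r
    simp [Set.indicator]
  rw [← integral_indicator hm, ← hind, integral_fun_norm_addHaar, finrank_euclideanSpace_fin,
    hball, hind', setIntegral_indicator measurableSet_Ioi,
    Set.inter_eq_self_of_subset_right (Set.Ioi_subset_Ioi zero_le_one),
    Gamma_add_one (by positivity)]
  simp only [nsmul_eq_mul, smul_eq_mul]
  field_simp

theorem integral_exitDensity {d : ℕ} (hd : d ≠ 0) {α : ℝ} (hα : α ∈ Set.Ioo (0:ℝ) 2) :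
    ∫ y in {y : EuclideanSpace ℝ (Fin d) | 1 < ‖y‖}, exitDensity d α y = 1 := by
  have hd' : (0:ℝ) < d := by positivity
  have hG : 0 < Gamma ((d:ℝ) / 2) := Gamma_pos_of_pos (by positivity)
  have hsin : 0 < sin (π * (α / 2)) :=
    sin_pos_of_pos_of_lt_pi (mul_pos pi_pos (by linarith [hα.1])) (by nlinarith [pi_pos, hα.2])
  have hpow : ∀ r ∈ Set.Ioi (1:ℝ),
      r ^ (d - 1) * ((r ^ 2 - 1) ^ (-(α / 2)) * r ^ (-(d:ℝ))) =
        (r ^ 2 - 1) ^ (-(α / 2)) * r⁻¹ := fun r (hr : 1 < r) ↦ by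
    have h0 : 0 < r := by positivity
    rw [rpow_neg h0.le, rpow_natCast, ← pow_sub_one_mul hd r]
    field_simp
  have hpi : π ^ (-((d:ℝ) / 2 + 1)) * (π ^ ((d:ℝ) / 2) * π) = 1 := by
    rw [← rpow_add_one pi_pos.ne', ← rpow_add pi_pos, neg_add_cancel, rpow_zero]
  simp only [exitDensity, mul_assoc, integral_const_mul]
  rw [integral_exterior_unitBall_fun_norm hd fun r ↦ (r ^ 2 - 1) ^ (-(α / 2)) * r ^ (-(d:ℝ)),
    setIntegral_congr_fun measurableSet_Ioi hpow,
    integral_Ioi_sq_sub_one_rpow_neg_mul_inv ⟨by linarith [hα.1], by linarith [hα.2]⟩,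
    mul_div_assoc π α 2]
  generalize π ^ (-((d:ℝ) / 2 + 1)) = p, sin (π * (α / 2)) = s at *
  field_simp
  linarith [hpi]

theorem stmt4 (d : ℕ) (hd : 2 ≤ d) (α : ℝ) (hα : α ∈ Set.Ioo (0:ℝ) 2) :
    (∫ y in {y : EuclideanSpace ℝ (Fin d) | 1 < ‖y‖}, exitDensity d α y) = 1 ∧
    IntegrableOn (exitDensity d α) {y : EuclideanSpace ℝ (Fin d) | 1 < ‖y‖} := by
  have h := integral_exitDensity (d := d) (by omega) hα
  exact ⟨h, .of_integral_ne_zero (by simp [h])⟩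
end

section
/- Let α ∈ (0,2) and r > 1. Then (2/π) sin(πα/2) ∫_1^r (s^2-1)^{-α/2} s^{-1} ds = 1 - I(1/r^2; α/2, 1-α/2). -/
open Real MeasureTheory

theorem ofReal_betaIntegrand_s5 {a b x : ℝ} (hx : 0 ≤ x) (hx' : x ≤ 1) :
    ((x ^ (a - 1) * (1 - x) ^ (b - 1) : ℝ) : ℂ) =
      (x : ℂ) ^ ((a : ℂ) - 1) * (1 - (x : ℂ)) ^ ((b : ℂ) - 1) := by
  rw [Complex.ofReal_mul, Complex.ofReal_cpow hx, Complex.ofReal_cpow (sub_nonneg.2 hx')]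
  push_cast
  rfl

theorem intervalIntegrable_betaIntegrand_s5 {a b : ℝ} (ha : 0 < a) (hb : 0 < b) :
    IntervalIntegrable (fun x : ℝ => x ^ (a - 1) * (1 - x) ^ (b - 1)) volume 0 1 := by
  have h := Complex.betaIntegral_convergent (u := a) (v := b) (by simpa) (by simpa)
  rw [intervalIntegrable_iff_integrableOn_Ioc_of_le zero_le_one] at h ⊢
  refine IntegrableOn.congr_fun (Integrable.re h) (fun x hx => ?_) measurableSet_Ioc
  simp only [← ofReal_betaIntegrand_s5 hx.1.le hx.2]
  exact Complex.ofReal_re _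

theorem integral_betaIntegrand_s5 {a b : ℝ} (ha : 0 < a) (hb : 0 < b) :
    ∫ x in (0:ℝ)..1, x ^ (a - 1) * (1 - x) ^ (b - 1) = betaFn a b := by
  have h := ProbabilityTheory.beta_eq_betaIntegralReal a b ha hb
  have hc : Complex.betaIntegral a b =
      ((∫ x in (0:ℝ)..1, x ^ (a - 1) * (1 - x) ^ (b - 1) : ℝ) : ℂ) := by
    rw [Complex.betaIntegral, ← intervalIntegral.integral_ofReal]
    refine intervalIntegral.integral_congr fun x hx => ?_
    rw [Set.uIcc_of_le zero_le_one] at hx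
    exact (ofReal_betaIntegrand_s5 hx.1 hx.2).symm
  rw [hc, Complex.ofReal_re] at h
  exact h.symm

theorem betaFn_one_sub (a : ℝ) : betaFn a (1 - a) = π / sin (π * a) := by
  rw [betaFn, Real.Gamma_mul_Gamma_one_sub]
  simp

/-- The substitution `u = 1 / s ^ 2` turns the integral on the left into an incomplete Beta
integral. -/
theorem two_mul_integral_sq_sub_one_rpow (a : ℝ) {r : ℝ} (hr : 1 < r) :
    2 * ∫ s in (1:ℝ)..r, (s ^ 2 - 1) ^ (-a) * s⁻¹ =
      ∫ u in (1 / r ^ 2)..1, u ^ (a - 1) * (1 - u) ^ (1 - a - 1) := by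
  have key := intervalIntegral.integral_comp_mul_deriv_of_deriv_nonpos (a := 1) (b := r)
    (f := fun s : ℝ => 1 / s ^ 2) (f' := fun s => -2 / s ^ 3)
    (g := fun u => u ^ (a - 1) * (1 - u) ^ (1 - a - 1)) ?_ ?_ ?_
  · rw [intervalIntegral.integral_symm 1 (1 / r ^ 2)]
    simp only [one_pow, div_one] at key
    rw [← key, ← intervalIntegral.integral_const_mul, ← intervalIntegral.integral_neg]
    refine intervalIntegral.integral_congr fun s hs => ?_
    rw [Set.uIcc_of_le hr.le] at hs
    have h0 : 0 < s := one_pos.trans_le hs.1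
    have h1 : 0 ≤ s ^ 2 - 1 := by nlinarith [hs.1]
    have h2 : 1 - 1 / s ^ 2 = (s ^ 2 - 1) / s ^ 2 := by field_simp
    simp only [Function.comp_apply]
    rw [h2, show 1 - a - 1 = -a by ring, div_rpow h1 (by positivity), one_div,
      inv_rpow (by positivity), ← rpow_neg (by positivity), show -(a - 1) = -a + 1 by ring,
      rpow_add_one (by positivity)]
    field_simp
  · rw [Set.uIcc_of_le hr.le]
    refine continuousOn_const.div (by fun_prop) fun s hs => ?_
    have h0 : 0 < s := one_pos.trans_le hs.1
    positivity
  · intro s hs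
    rw [min_eq_left hr.le] at hs
    have h0 : 0 < s := one_pos.trans hs.1
    convert! (hasDerivAt_const s (1 : ℝ)).div (hasDerivAt_pow 2 s) (by positivity) using 1
    field_simp
    norm_num
  · intro s hs
    rw [min_eq_left hr.le] at hs
    have h0 : 0 < s := one_pos.trans hs.1
    exact div_nonpos_of_nonpos_of_nonneg (by norm_num) (by positivity)

theorem stmt5 (α : ℝ) (hα : α ∈ Set.Ioo (0:ℝ) 2) (r : ℝ) (hr : 1 < r) :
    2 / Real.pi * Real.sin (Real.pi * α / 2) *
        (∫ s in (1:ℝ)..r, (s^2 - 1) ^ (-(α/2)) * s⁻¹)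
      = 1 - regIncBeta (1 / r^2) (α/2) (1 - α/2) := by
  have ha : 0 < α / 2 := by linarith [hα.1]
  have hb : 0 < 1 - α / 2 := by linarith [hα.2]
  have hx0 : 0 ≤ 1 / r ^ 2 := by positivity
  have hx1 : 1 / r ^ 2 ≤ 1 := by
    rw [div_le_one (by positivity)]
    nlinarith
  have hint := intervalIntegrable_betaIntegrand_s5 ha hb
  have hmem : 1 / r ^ 2 ∈ Set.uIcc (0:ℝ) 1 := by
    rw [Set.uIcc_of_le zero_le_one]
    exact ⟨hx0, hx1⟩
  have hsplit := intervalIntegral.integral_add_adjacent_intervals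
    (hint.mono_set (Set.uIcc_subset_uIcc_left hmem))
    (hint.mono_set (Set.uIcc_subset_uIcc_right hmem))
  rw [integral_betaIntegrand_s5 ha hb, ← two_mul_integral_sq_sub_one_rpow _ hr] at hsplit
  have hB : betaFn (α / 2) (1 - α / 2) ≠ 0 := (ProbabilityTheory.beta_pos ha hb).ne'
  have hsin : 2 / π * sin (π * α / 2) = 2 / betaFn (α / 2) (1 - α / 2) := by
    rw [betaFn_one_sub, div_div_eq_mul_div, mul_div_assoc π, div_mul_eq_mul_div]
  rw [hsin, regIncBeta, div_mul_eq_mul_div, eq_sub_iff_add_eq, ← add_div, add_comm, hsplit,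
    div_self hB]
end

section
/- Let α ∈ (0,2). Then the function s ↦ (s^2-1)^{-α/2} s^{-1} is integrable on (1,∞) and (2/π) sin(πα/2) ∫_1^∞ (s^2-1)^{-α/2} s^{-1} ds = 1; that is, f_{R_X}(s) = (2/π) sin(πα/2) (s^2-1)^{-α/2} s^{-1} is a probability density on (1,∞). -/
open Real MeasureTheory

theorem ofReal_beta_integrand (u v : ℝ) {x : ℝ} (hx : x ∈ Set.Ioo (0 : ℝ) 1) :
    (x : ℂ) ^ ((u : ℂ) - 1) * (1 - (x : ℂ)) ^ ((v : ℂ) - 1) =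
      ((x ^ (u - 1) * (1 - x) ^ (v - 1) : ℝ) : ℂ) := by
  rw [Complex.ofReal_mul, Complex.ofReal_cpow hx.1.le,
    Complex.ofReal_cpow (sub_nonneg.2 hx.2.le)]
  push_cast
  rfl

theorem integrableOn_beta_integrand {u v : ℝ} (hu : 0 < u) (hv : 0 < v) :
    IntegrableOn (fun x : ℝ => x ^ (u - 1) * (1 - x) ^ (v - 1)) (Set.Ioo 0 1) := by
  have h := Complex.betaIntegral_convergent (u := u) (v := v) (by simpa) (by simpa)
  rw [intervalIntegrable_iff_integrableOn_Ioo_of_le zero_le_one] at h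
  exact ((integrableOn_congr_fun (fun x hx => ofReal_beta_integrand u v hx)
    measurableSet_Ioo).1 h).re

theorem integral_beta_integrand {u v : ℝ} (hu : 0 < u) (hv : 0 < v) :
    ∫ x in Set.Ioo (0 : ℝ) 1, x ^ (u - 1) * (1 - x) ^ (v - 1) =
      Real.Gamma u * Real.Gamma v / Real.Gamma (u + v) := by
  have h := Complex.betaIntegral_eq_Gamma_mul_div u v (by simpa) (by simpa)
  rw [Complex.betaIntegral, intervalIntegral.integral_of_le zero_le_one,
    integral_Ioc_eq_integral_Ioo,
    setIntegral_congr_fun measurableSet_Ioo (fun x hx => ofReal_beta_integrand u v hx),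
    integral_complex_ofReal, ← Complex.ofReal_add] at h
  simp only [Complex.Gamma_ofReal] at h
  exact_mod_cast h

theorem image_rpow_neg_half_Ioo :
    (fun t : ℝ => t ^ (-(1 / 2) : ℝ)) '' Set.Ioo 0 1 = Set.Ioi 1 := by
  ext s
  constructor
  · rintro ⟨t, ht, rfl⟩
    exact Real.one_lt_rpow_of_pos_of_lt_one_of_neg ht.1 ht.2 (by norm_num)
  · intro hs
    have hs1 : (1 : ℝ) < s := hs
    have hs0 : 0 < s := one_pos.trans hs1
    refine ⟨s ^ (-2 : ℝ), ⟨by positivity,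
      Real.rpow_lt_one_of_one_lt_of_neg hs1 (by norm_num)⟩, ?_⟩
    simp only
    rw [← Real.rpow_mul hs0.le]
    norm_num

theorem injOn_rpow_neg_half_Ioo :
    Set.InjOn (fun t : ℝ => t ^ (-(1 / 2) : ℝ)) (Set.Ioo 0 1) := fun _ hx _ hy h =>
  (Real.rpow_left_inj hx.1.le hy.1.le (by norm_num)).1 h

theorem hasDerivWithinAt_rpow_neg_half {t : ℝ} (ht : t ∈ Set.Ioo (0 : ℝ) 1) :
    HasDerivWithinAt (fun t : ℝ => t ^ (-(1 / 2) : ℝ)) (-(1 / 2) * t ^ (-(1 / 2) - 1 : ℝ))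
      (Set.Ioo 0 1) t :=
  (Real.hasDerivAt_rpow_const (Or.inl ht.1.ne')).hasDerivWithinAt

theorem density_comp_rpow_neg_half (a : ℝ) {t : ℝ} (ht : t ∈ Set.Ioo (0 : ℝ) 1) :
    |-(1 / 2) * t ^ (-(1 / 2) - 1 : ℝ)| •
        (((t ^ (-(1 / 2) : ℝ)) ^ 2 - 1) ^ (-a) * (t ^ (-(1 / 2) : ℝ))⁻¹) =
      1 / 2 * (t ^ (a - 1) * (1 - t) ^ ((1 - a) - 1)) := by
  obtain ⟨h0, h1⟩ := ht
  have hsq : (t ^ (-(1 / 2) : ℝ)) ^ 2 - 1 = (1 - t) * t ^ (-1 : ℝ) := by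
    rw [← Real.rpow_natCast, ← Real.rpow_mul h0.le]
    norm_num [Real.rpow_neg_one]
    field_simp
  have habs : |-(1 / 2) * t ^ (-(1 / 2) - 1 : ℝ)| = 1 / 2 * t ^ (-(1 / 2) - 1 : ℝ) := by
    rw [abs_mul, abs_of_pos (Real.rpow_pos_of_pos h0 _)]
    norm_num
  have hexp : t ^ (a - 1) = t ^ (-(1 / 2) - 1 : ℝ) * t ^ (-1 * -a) * t ^ (-(-(1 / 2)) : ℝ) := by
    rw [← Real.rpow_add h0, ← Real.rpow_add h0]
    ring_nf
  rw [hsq, habs, Real.mul_rpow (sub_nonneg.2 h1.le) (by positivity), ← Real.rpow_mul h0.le,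
    ← Real.rpow_neg h0.le, hexp, show (1 - a) - 1 = -a by ring, smul_eq_mul]
  ring

theorem stmt6 (α : ℝ) (hα : α ∈ Set.Ioo (0:ℝ) 2) :
    IntegrableOn (fun s : ℝ => (s^2 - 1) ^ (-(α/2)) * s⁻¹) (Set.Ioi (1:ℝ)) ∧
    2 / Real.pi * Real.sin (Real.pi * α / 2) *
        (∫ s in Set.Ioi (1:ℝ), (s^2 - 1) ^ (-(α/2)) * s⁻¹) = 1 := by
  have ha : 0 < α / 2 := by linarith [hα.1]
  have hb : 0 < 1 - α / 2 := by linarith [hα.2]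
  rw [← image_rpow_neg_half_Ioo]
  constructor
  · rw [integrableOn_image_iff_integrableOn_abs_deriv_smul measurableSet_Ioo
      (fun t ht => hasDerivWithinAt_rpow_neg_half ht) injOn_rpow_neg_half_Ioo,
      integrableOn_congr_fun (fun t ht => density_comp_rpow_neg_half (α / 2) ht)
        measurableSet_Ioo]
    exact (integrableOn_beta_integrand ha hb).const_mul _
  · have hsin : 0 < Real.sin (Real.pi * (α / 2)) :=
      Real.sin_pos_of_pos_of_lt_pi (by positivity) (by nlinarith [Real.pi_pos])
    rw [integral_image_eq_integral_abs_deriv_smul measurableSet_Ioo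
      (fun t ht => hasDerivWithinAt_rpow_neg_half ht) injOn_rpow_neg_half_Ioo,
      setIntegral_congr_fun measurableSet_Ioo
        (fun t ht => density_comp_rpow_neg_half (α / 2) ht),
      integral_const_mul, integral_beta_integrand ha hb, Real.Gamma_mul_Gamma_one_sub,
      add_sub_cancel, Real.Gamma_one, mul_div_assoc Real.pi α 2]
    generalize Real.sin (Real.pi * (α / 2)) = x at hsin ⊢
    field_simp
end
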